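/- For every ρ with ρ* < ρ < 1, the map f_ρ has exactly one real fixed point, i.e. the set {x ∈ ℝ : f_ρ(x) = x} is a singleton; the two additional fixed points present for ρ < ρ* have been annihilated in the saddle-node bifurcation at ρ = ρ*. -/

import Mathlib

/-- The one-parameter family of polynomial maps `f_ρ`. -/
noncomputable def fmap (ρ x : ℝ) : ℝ :=
  (ρ - 1) * (8 * x ^ 3 - 9 * x ^ 2) + 2 * ρ * x - x + ρ

/-- The critical parameter value of the saddle-node bifurcation. -/
noncomputable def ρstar : ℝ := (33 * Real.sqrt 33 - 115) / 668

/-- A fixed point of `f_ρ` is a solution of `8x³ - 9x² + 2x = ρ / (1 - ρ)`. -/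
lemma fmap_eq_self_iff {ρ : ℝ} (h1 : ρ < 1) (x : ℝ) :
    fmap ρ x = x ↔ 8 * x ^ 3 - 9 * x ^ 2 + 2 * x = ρ / (1 - ρ) := by
  have h : 0 < 1 - ρ := by linarith
  rw [eq_div_iff h.ne', fmap]
  constructor <;> intro h <;> linear_combination -h

/-- The local maximum value of `8x³ - 9x² + 2x` corresponds to the parameter `ρstar`. -/
lemma lt_div_of_ρstar_lt {ρ : ℝ} (h0 : ρstar < ρ) (h1 : ρ < 1) :
    (11 * √33 - 27) / 288 < ρ / (1 - ρ) := by
  have h : 0 < 1 - ρ := by linarith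
  have hs : √33 ^ 2 = 33 := Real.sq_sqrt (by norm_num)
  have hs0 : 0 ≤ √33 := Real.sqrt_nonneg 33
  rw [lt_div_iff₀ h]
  have key : 0 < (ρ - ρstar) * (261 + 11 * √33) := mul_pos (by linarith) (by linarith)
  have e : ρstar * (261 + 11 * √33) = 11 * √33 - 27 := by
    rw [ρstar]
    linear_combination (363 / 668) * hs
  linarith

/-- Above its local maximum value, the cubic `8x³ - 9x² + 2x` is only attained to the right of
the second preimage of that value. -/
lemma lt_of_localMax_lt_cubic {x : ℝ}
    (h : (11 * √33 - 27) / 288 < 8 * x ^ 3 - 9 * x ^ 2 + 2 * x) : (9 + 2 * √33) / 24 < x := by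
  have hs : √33 ^ 2 = 33 := Real.sq_sqrt (by norm_num)
  have e : 8 * x ^ 3 - 9 * x ^ 2 + 2 * x - (11 * √33 - 27) / 288 =
      8 * (x - (9 - √33) / 24) ^ 2 * (x - (9 + 2 * √33) / 24) := by
    linear_combination (x / 24 + √33 / 864 - 1 / 64) * hs
  have hpos : 0 < 8 * (x - (9 - √33) / 24) ^ 2 * (x - (9 + 2 * √33) / 24) := by linarith
  linarith [pos_of_mul_pos_right hpos (by positivity)]

/-- For `ρ* < ρ < 1`, the map `f_ρ` has exactly one real fixed point: the two additional fixed
points present for `ρ < ρ*` have been annihilated in the saddle-node bifurcation at `ρ = ρ*`. -/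
theorem stmt_8 (ρ : ℝ) (h0 : ρstar < ρ) (h1 : ρ < 1) :
    ∃! x : ℝ, fmap ρ x = x := by
  have h33 : 5 < √33 := Real.lt_sqrt_of_sq_lt (by norm_num)
  have hc := lt_div_of_ρstar_lt h0 h1
  simp only [fmap_eq_self_iff h1]
  generalize ρ / (1 - ρ) = c at hc ⊢
  have hc0 : 0 < c := by linarith
  obtain ⟨x, -, hx⟩ := intermediate_value_Icc (show (0 : ℝ) ≤ 1 + c by linarith)
    (f := fun x : ℝ ↦ 8 * x ^ 3 - 9 * x ^ 2 + 2 * x) (by fun_prop)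
    (show c ∈ Set.Icc _ _ from ⟨by norm_num [hc0.le], by
      have : 0 ≤ 1 + 7 * c + 15 * c ^ 2 + 8 * c ^ 3 := by positivity
      linarith⟩)
  refine ⟨x, hx, fun y hy ↦ ?_⟩
  have hx' : 3 / 4 < x := by linarith [lt_of_localMax_lt_cubic (hc.trans_eq hx.symm)]
  have hy' : 3 / 4 < y := by linarith [lt_of_localMax_lt_cubic (hc.trans_eq hy.symm)]
  have hprod : (y - x) * (8 * (y ^ 2 + x * y + x ^ 2) - 9 * (x + y) + 2) = 0 := by
    linear_combination hy - hx
  rcases mul_eq_zero.mp hprod with h | h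
  · linarith
  · nlinarith [mul_pos (sub_pos.2 hx') (sub_pos.2 hy'), sq_nonneg (x - 3 / 4),
      sq_nonneg (y - 3 / 4)]
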